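/- Let (B₁,B₂,i,j) be an ADHM datum satisfying both ADHM equations (1) and (2). Then the following are equivalent: (a) the datum is regular, i.e. the only unitary operator g of V satisfying g∘B₁ = B₁∘g, g∘B₂ = B₂∘g, g∘i = i and j∘g = j is g = 1; (b) the datum is stable; (c) the datum is costable. -/

import Mathlib

open scoped InnerProductSpace in
lemma adhm_aux_one {V : Type*} [NormedAddCommGroup V] [InnerProductSpace ℂ V]
    [FiniteDimensional ℂ V] (A : V →ₗ[ℂ] V) (T : Submodule ℂ V) (hA : ∀ x ∈ T, A x ∈ T)
    {n : ℕ} (e : OrthonormalBasis (Fin n) ℂ T) :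
    ∑ a, ‖LinearMap.adjoint A (e a : V)‖ ^ 2 = ∑ a, ‖A (e a : V)‖ ^ 2 +
      ∑ a, ‖Tᗮ.starProjection (LinearMap.adjoint A (e a : V))‖ ^ 2 := by
  set C : T →ₗ[ℂ] T := A.restrict hA with hC
  have h1 : ∀ x : T, LinearMap.adjoint C x = T.orthogonalProjectionOnto (LinearMap.adjoint A (x : V)) := by
    intro x
    refine ext_inner_right ℂ fun y => ?_
    rw [LinearMap.adjoint_inner_left, Submodule.inner_orthogonalProjectionOnto_eq_of_mem_right,
      LinearMap.adjoint_inner_left]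
    rfl
  have h2 : ∑ a, ‖LinearMap.adjoint C (e a)‖ ^ 2 = ∑ a, ‖C (e a)‖ ^ 2 := by
    have h := LinearMap.trace_mul_comm ℂ C (LinearMap.adjoint C)
    rw [LinearMap.trace_eq_sum_inner _ e, LinearMap.trace_eq_sum_inner _ e] at h
    simp only [Module.End.mul_apply] at h
    have h3 : ∀ x : T, ⟪x, C (LinearMap.adjoint C x)⟫_ℂ = ((‖LinearMap.adjoint C x‖ ^ 2 : ℝ) : ℂ) := by
      intro x
      rw [← LinearMap.adjoint_inner_left, inner_self_eq_norm_sq_to_K]; simp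
    have h4 : ∀ x : T, ⟪x, LinearMap.adjoint C (C x)⟫_ℂ = ((‖C x‖ ^ 2 : ℝ) : ℂ) := by
      intro x
      rw [LinearMap.adjoint_inner_right, inner_self_eq_norm_sq_to_K]; simp
    simp only [h3, h4] at h
    exact_mod_cast h
  have h5 : ∀ a, ‖C (e a)‖ = ‖A (e a : V)‖ := fun a => rfl
  simp only [h5] at h2
  rw [← h2, ← Finset.sum_add_distrib]
  refine Finset.sum_congr rfl fun a _ => ?_
  rw [h1, Submodule.norm_sq_eq_add_norm_sq_starProjection (LinearMap.adjoint A (e a : V)) T]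
  rfl

open scoped InnerProductSpace in
lemma adhm_aux_two {V W : Type*} [NormedAddCommGroup V] [InnerProductSpace ℂ V]
    [FiniteDimensional ℂ V] [NormedAddCommGroup W] [InnerProductSpace ℂ W] [FiniteDimensional ℂ W]
    (B₁ B₂ : V →ₗ[ℂ] V) (i : W →ₗ[ℂ] V) (j : V →ₗ[ℂ] W)
    (eq2 : B₁ ∘ₗ LinearMap.adjoint B₁ - LinearMap.adjoint B₁ ∘ₗ B₁
         + (B₂ ∘ₗ LinearMap.adjoint B₂ - LinearMap.adjoint B₂ ∘ₗ B₂)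
         + i ∘ₗ LinearMap.adjoint i - LinearMap.adjoint j ∘ₗ j = 0)
    (T : Submodule ℂ V) (h₁ : ∀ x ∈ T, B₁ x ∈ T) (h₂ : ∀ x ∈ T, B₂ x ∈ T)
    (hj : ∀ x ∈ T, j x = 0) :
    (∀ x ∈ T, LinearMap.adjoint B₁ x ∈ T) ∧ (∀ x ∈ T, LinearMap.adjoint B₂ x ∈ T) ∧
      (∀ x ∈ T, LinearMap.adjoint i x = 0) := by
  let e := stdOrthonormalBasis ℂ T
  have key : ∀ x ∈ T, ‖LinearMap.adjoint B₁ x‖ ^ 2 - ‖B₁ x‖ ^ 2 +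
      (‖LinearMap.adjoint B₂ x‖ ^ 2 - ‖B₂ x‖ ^ 2) + ‖LinearMap.adjoint i x‖ ^ 2 = 0 := by
    intro x hx
    have h := congrArg (fun f : V →ₗ[ℂ] V => ⟪x, f x⟫_ℂ) eq2
    simp only [LinearMap.sub_apply, LinearMap.add_apply, LinearMap.comp_apply, inner_sub_right,
      inner_add_right, LinearMap.adjoint_inner_right, hj x hx, LinearMap.zero_apply,
      inner_zero_right, sub_zero] at h
    rw [← LinearMap.adjoint_inner_left B₁, ← LinearMap.adjoint_inner_left B₂,
      ← LinearMap.adjoint_inner_left i] at h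
    simp only [inner_self_eq_norm_sq_to_K] at h
    apply Complex.ofReal_injective
    push_cast
    exact h
  have hs : ∑ a, (‖LinearMap.adjoint B₁ (e a : V)‖ ^ 2 - ‖B₁ (e a : V)‖ ^ 2 +
      (‖LinearMap.adjoint B₂ (e a : V)‖ ^ 2 - ‖B₂ (e a : V)‖ ^ 2)
        + ‖LinearMap.adjoint i (e a : V)‖ ^ 2) = 0 :=
    Finset.sum_eq_zero fun a _ => key _ (e a).2
  simp only [Finset.sum_add_distrib, Finset.sum_sub_distrib] at hs
  rw [adhm_aux_one B₁ T h₁ e, adhm_aux_one B₂ T h₂ e] at hs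
  have hs' : ∑ a, (‖Tᗮ.starProjection (LinearMap.adjoint B₁ (e a : V))‖ ^ 2 +
      ‖Tᗮ.starProjection (LinearMap.adjoint B₂ (e a : V))‖ ^ 2 +
        ‖LinearMap.adjoint i (e a : V)‖ ^ 2) = 0 := by
    simp only [Finset.sum_add_distrib]; linarith
  rw [Finset.sum_eq_zero_iff_of_nonneg (fun a _ => by positivity)] at hs'
  have ext : ∀ {U : Type _} [NormedAddCommGroup U] [InnerProductSpace ℂ U] (f : V →ₗ[ℂ] U),
      (∀ a, ‖f (e a : V)‖ ^ 2 = 0) → ∀ x ∈ T, f x = 0 := by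
    intro U _ _ f hf x hx
    have : f ∘ₗ T.subtype = 0 := e.toBasis.ext fun a => by
      simpa using hf a
    exact congrArg (fun g : T →ₗ[ℂ] U => g ⟨x, hx⟩) this
  have ext' : ∀ f : V →ₗ[ℂ] W,
      (∀ a, ‖f (e a : V)‖ ^ 2 = 0) → ∀ x ∈ T, f x = 0 := by
    intro f hf x hx
    have : f ∘ₗ T.subtype = 0 := e.toBasis.ext fun a => by
      simpa using hf a
    exact congrArg (fun g : T →ₗ[ℂ] W => g ⟨x, hx⟩) this
  have mem : ∀ y : V, Tᗮ.starProjection y = 0 → y ∈ T := by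
    intro y hy
    rw [Submodule.starProjection_apply_eq_zero_iff, Submodule.orthogonal_orthogonal] at hy
    exact hy
  refine ⟨fun x hx => mem _ ?_, fun x hx => mem _ ?_, ext' _ fun a => ?_⟩
  · refine ext ((Tᗮ.starProjection : V →ₗ[ℂ] V) ∘ₗ LinearMap.adjoint B₁) (fun a => ?_) x hx
    have := hs' a (Finset.mem_univ a)
    refine le_antisymm ?_ (by positivity)
    simp only [LinearMap.comp_apply, ContinuousLinearMap.coe_coe]
    nlinarith [sq_nonneg ‖Tᗮ.starProjection (LinearMap.adjoint B₂ (e a : V))‖,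
      sq_nonneg ‖LinearMap.adjoint i (e a : V)‖]
  · refine ext ((Tᗮ.starProjection : V →ₗ[ℂ] V) ∘ₗ LinearMap.adjoint B₂) (fun a => ?_) x hx
    have := hs' a (Finset.mem_univ a)
    refine le_antisymm ?_ (by positivity)
    simp only [LinearMap.comp_apply, ContinuousLinearMap.coe_coe]
    nlinarith [sq_nonneg ‖Tᗮ.starProjection (LinearMap.adjoint B₁ (e a : V))‖,
      sq_nonneg ‖LinearMap.adjoint i (e a : V)‖]
  · have := hs' a (Finset.mem_univ a)
    nlinarith [sq_nonneg ‖Tᗮ.starProjection (LinearMap.adjoint B₁ (e a : V))‖,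
      sq_nonneg ‖Tᗮ.starProjection (LinearMap.adjoint B₂ (e a : V))‖,
      sq_nonneg ‖LinearMap.adjoint i (e a : V)‖]

lemma adhm_orth {V : Type*} [NormedAddCommGroup V] [InnerProductSpace ℂ V]
    [FiniteDimensional ℂ V] (A : V →ₗ[ℂ] V) (T : Submodule ℂ V)
    (h : ∀ x ∈ T, LinearMap.adjoint A x ∈ T) : ∀ x ∈ Tᗮ, A x ∈ Tᗮ := by
  intro x hx
  rw [Submodule.mem_orthogonal] at hx ⊢
  intro u hu
  rw [← LinearMap.adjoint_inner_left]
  exact hx _ (h u hu)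

lemma adhm_range {V W : Type*} [NormedAddCommGroup V] [InnerProductSpace ℂ V]
    [FiniteDimensional ℂ V] [NormedAddCommGroup W] [InnerProductSpace ℂ W] [FiniteDimensional ℂ W]
    (i : W →ₗ[ℂ] V) (T : Submodule ℂ V)
    (h : ∀ x ∈ T, LinearMap.adjoint i x = 0) : ∀ w, i w ∈ Tᗮ := by
  intro w
  rw [Submodule.mem_orthogonal]
  intro u hu
  rw [← LinearMap.adjoint_inner_left, h u hu, inner_zero_left]

lemma adhm_comm {V : Type*} [NormedAddCommGroup V] [InnerProductSpace ℂ V]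
    [FiniteDimensional ℂ V] (A : V →ₗ[ℂ] V) (T : Submodule ℂ V)
    (h : ∀ x ∈ T, A x ∈ T) (h' : ∀ x ∈ T, LinearMap.adjoint A x ∈ T) (v : V) :
    Tᗮ.reflection (A v) = A (Tᗮ.reflection v) := by
  obtain ⟨t, ht, s, hs, rfl⟩ := T.exists_add_mem_mem_orthogonal v
  have hT : ∀ x ∈ T, Tᗮ.reflection x = -x := fun x hx =>
    Submodule.reflection_mem_subspace_orthogonalComplement_eq_neg
      (by rwa [Submodule.orthogonal_orthogonal])
  have hS : ∀ x ∈ Tᗮ, Tᗮ.reflection x = x := fun x hx =>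
    Submodule.reflection_mem_subspace_eq_self hx
  simp only [map_add, hT _ ht, hS _ hs, hT _ (h _ ht), hS _ (adhm_orth A T h' _ hs), map_neg]


/-- Let `(B₁,B₂,i,j)` be an ADHM datum satisfying both ADHM equations. Then the following
are equivalent: (a) the datum is regular, i.e. the only unitary operator `g` of `V` with
`g∘B₁ = B₁∘g`, `g∘B₂ = B₂∘g`, `g∘i = i` and `j∘g = j` is `g = 1`; (b) the datum is stable;
(c) the datum is costable. -/
theorem adhm_regular_iff_stable_iff_costable
    {V W : Type*} [NormedAddCommGroup V] [InnerProductSpace ℂ V] [FiniteDimensional ℂ V]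
    [NormedAddCommGroup W] [InnerProductSpace ℂ W] [FiniteDimensional ℂ W]
    (B₁ B₂ : V →ₗ[ℂ] V) (i : W →ₗ[ℂ] V) (j : V →ₗ[ℂ] W)
    (eq1 : B₁ ∘ₗ B₂ - B₂ ∘ₗ B₁ + i ∘ₗ j = 0)
    (eq2 : B₁ ∘ₗ LinearMap.adjoint B₁ - LinearMap.adjoint B₁ ∘ₗ B₁
         + (B₂ ∘ₗ LinearMap.adjoint B₂ - LinearMap.adjoint B₂ ∘ₗ B₂)
         + i ∘ₗ LinearMap.adjoint i - LinearMap.adjoint j ∘ₗ j = 0) :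
    ((∀ g : V →ₗ[ℂ] V,
        LinearMap.adjoint g ∘ₗ g = LinearMap.id →
        g ∘ₗ LinearMap.adjoint g = LinearMap.id →
        g ∘ₗ B₁ = B₁ ∘ₗ g → g ∘ₗ B₂ = B₂ ∘ₗ g → g ∘ₗ i = i → j ∘ₗ g = j →
        g = LinearMap.id)
      ↔
     (¬ ∃ S : Submodule ℂ V, S ≠ ⊤ ∧ S.map B₁ ≤ S ∧ S.map B₂ ≤ S ∧ LinearMap.range i ≤ S))
    ∧
    ((¬ ∃ S : Submodule ℂ V, S ≠ ⊤ ∧ S.map B₁ ≤ S ∧ S.map B₂ ≤ S ∧ LinearMap.range i ≤ S)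
      ↔
     (¬ ∃ S : Submodule ℂ V, S ≠ ⊥ ∧ S.map B₁ ≤ S ∧ S.map B₂ ≤ S ∧ S ≤ LinearMap.ker j)) := by

  have toQ1 : ∀ S : Submodule ℂ V, (S.map B₁ ≤ S ∧ S.map B₂ ≤ S ∧ S ≤ LinearMap.ker j) →
      (∀ x ∈ S, LinearMap.adjoint B₁ x ∈ S) ∧ (∀ x ∈ S, LinearMap.adjoint B₂ x ∈ S) ∧
      (∀ x ∈ S, LinearMap.adjoint i x = 0) := by
    rintro S ⟨h1, h2, h3⟩
    exact adhm_aux_two B₁ B₂ i j eq2 S (fun x hx => h1 ⟨x, hx, rfl⟩) (fun x hx => h2 ⟨x, hx, rfl⟩)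
      (fun x hx => h3 hx)
  have toC : (∃ S : Submodule ℂ V, S ≠ ⊤ ∧ S.map B₁ ≤ S ∧ S.map B₂ ≤ S ∧ LinearMap.range i ≤ S) →
      ∃ S : Submodule ℂ V, S ≠ ⊥ ∧ S.map B₁ ≤ S ∧ S.map B₂ ≤ S ∧ S ≤ LinearMap.ker j := by
    rintro ⟨S, h0, h1, h2, h3⟩
    have := adhm_aux_two (LinearMap.adjoint B₁) (LinearMap.adjoint B₂) (LinearMap.adjoint j)
      (LinearMap.adjoint i) (by
        simp only [LinearMap.adjoint_adjoint]
        rw [← neg_eq_zero, ← eq2]; abel) Sᗮ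
      (adhm_orth _ _ fun x hx => by
        rw [LinearMap.adjoint_adjoint]; exact h1 ⟨x, hx, rfl⟩)
      (adhm_orth _ _ fun x hx => by
        rw [LinearMap.adjoint_adjoint]; exact h2 ⟨x, hx, rfl⟩)
      (fun x hx => by
        refine ext_inner_right ℂ fun w => ?_
        rw [LinearMap.adjoint_inner_left, inner_zero_left]
        exact Submodule.inner_left_of_mem_orthogonal (h3 ⟨w, rfl⟩) hx)
    simp only [LinearMap.adjoint_adjoint] at this
    obtain ⟨a, b, c⟩ := this
    refine ⟨Sᗮ, fun h => h0 (Submodule.orthogonal_eq_bot_iff.1 h), ?_, ?_, fun x hx => c x hx⟩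
    · rintro _ ⟨x, hx, rfl⟩; exact a x hx
    · rintro _ ⟨x, hx, rfl⟩; exact b x hx
  have toS : (∃ S : Submodule ℂ V, S ≠ ⊥ ∧ S.map B₁ ≤ S ∧ S.map B₂ ≤ S ∧ S ≤ LinearMap.ker j) →
      ∃ S : Submodule ℂ V, S ≠ ⊤ ∧ S.map B₁ ≤ S ∧ S.map B₂ ≤ S ∧ LinearMap.range i ≤ S := by
    rintro ⟨S, h0, hS⟩
    obtain ⟨a, b, c⟩ := toQ1 S hS
    refine ⟨Sᗮ, fun h => h0 ((Submodule.orthogonal_eq_top_iff S).1 h), ?_, ?_, ?_⟩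
    · rintro _ ⟨x, hx, rfl⟩; exact adhm_orth _ _ a x hx
    · rintro _ ⟨x, hx, rfl⟩; exact adhm_orth _ _ b x hx
    · rintro _ ⟨w, rfl⟩; exact adhm_range i S c w
  refine ⟨⟨?_, ?_⟩, not_congr ⟨toC, toS⟩⟩
  · intro hreg hst
    obtain ⟨T, h0, hT⟩ := toC hst
    obtain ⟨a, b, c⟩ := toQ1 T hT
    obtain ⟨h1, h2, h3⟩ := hT
    have hTn : ∀ x ∈ T, Tᗮ.reflection x = -x := fun x hx =>
      Submodule.reflection_mem_subspace_orthogonalComplement_eq_neg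
        (by rwa [Submodule.orthogonal_orthogonal])
    have hSn : ∀ x ∈ Tᗮ, Tᗮ.reflection x = x := fun x hx =>
      Submodule.reflection_mem_subspace_eq_self hx
    let g : V →ₗ[ℂ] V := Tᗮ.reflection.toLinearEquiv.toLinearMap
    have hg : ∀ x, g x = Tᗮ.reflection x := fun x => rfl
    have hgg : LinearMap.adjoint g ∘ₗ g = LinearMap.id := by
      ext x
      refine ext_inner_right ℂ fun y => ?_
      rw [LinearMap.comp_apply, LinearMap.adjoint_inner_left, hg, hg,
        LinearIsometryEquiv.inner_map_map]
      rfl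
    have hid := hreg g hgg (mul_eq_one_comm.1 hgg)
      (by ext x; exact adhm_comm B₁ T (fun x hx => h1 ⟨x, hx, rfl⟩) a x)
      (by ext x; exact adhm_comm B₂ T (fun x hx => h2 ⟨x, hx, rfl⟩) b x)
      (by ext w; exact hSn _ (adhm_range i T c w))
      (by
        ext v
        obtain ⟨t, ht, s, hs, rfl⟩ := T.exists_add_mem_mem_orthogonal v
        have : j t = 0 := h3 ht
        simp only [LinearMap.comp_apply, hg, map_add, hTn _ ht, hSn _ hs, map_neg, this, neg_zero])
    apply h0
    rw [Submodule.eq_bot_iff]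
    intro x hx
    have h := hTn x hx
    rw [← hg, hid, LinearMap.id_apply] at h
    have : IsAddTorsionFree V := .of_isTorsionFree ℂ V
    exact self_eq_neg.1 h
  · intro hst g _ _ g1 g2 gi _
    by_contra hne
    refine hst ⟨LinearMap.ker (g - LinearMap.id), fun h => hne ?_, ?_, ?_, ?_⟩
    · exact sub_eq_zero.1 (LinearMap.ker_eq_top.1 h)
    · rintro _ ⟨x, hx, rfl⟩
      have hx : g x - x = 0 := hx
      change g (B₁ x) - B₁ x = 0
      rw [← LinearMap.comp_apply, g1, LinearMap.comp_apply, ← map_sub, hx, map_zero]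
    · rintro _ ⟨x, hx, rfl⟩
      have hx : g x - x = 0 := hx
      change g (B₂ x) - B₂ x = 0
      rw [← LinearMap.comp_apply, g2, LinearMap.comp_apply, ← map_sub, hx, map_zero]
    · rintro _ ⟨w, rfl⟩
      change g (i w) - i w = 0
      rw [← LinearMap.comp_apply, gi, sub_self]
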